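/- For every positive real z, Γ(z) ≥ √(2π) · z^{z-1/2} · e^{-z}. -/

import Mathlib

open Real

noncomputable def muAux (x : ℝ) : ℝ :=
  Real.log (Real.Gamma x) - (x - 1/2) * Real.log x + x - Real.log (2 * π) / 2

lemma muAux_step (x : ℝ) (hx : 0 < x) : muAux (x + 1) ≤ muAux x := by
  have h1 : Real.log (Real.Gamma (x + 1)) = Real.log x + Real.log (Real.Gamma x) := by
    rw [Real.Gamma_add_one hx.ne', Real.log_mul hx.ne' (Real.Gamma_pos_of_pos hx).ne']
  have h2 := Real.le_log_one_add_of_nonneg (x := 1 / x) (by positivity)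
  have h3 : Real.log (1 + 1 / x) = Real.log (x + 1) - Real.log x := by
    rw [← Real.log_div (by positivity) hx.ne']; congr 1; field_simp
  have h4 : 2 * (1 / x) / (1 / x + 2) = 1 / (x + 1/2) := by field_simp; ring
  rw [h3, h4, div_le_iff₀ (by positivity)] at h2
  unfold muAux
  rw [h1]
  nlinarith

lemma muAux_nat (x : ℝ) (hx : 0 < x) (n : ℕ) : muAux (x + n) ≤ muAux x := by
  induction n with
  | zero => simp
  | succ k ih =>
    have := muAux_step (x + k) (by positivity)
    push_cast
    rw [← add_assoc]
    linarith

lemma muAux_ge (z : ℝ) (hz : 0 < z) (n : ℕ) (hn : 2 ≤ n) :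
    - (z * (z + 1)) / ((n : ℝ) - 1) ≤ muAux (z + n) := by
  have hn2 : (2 : ℝ) ≤ n := by exact_mod_cast hn
  have hn0 : (0 : ℝ) < n := by linarith
  have hn1 : (0 : ℝ) < (n : ℝ) - 1 := by linarith
  have h1 := Real.BohrMollerup.f_add_nat_ge (f := Real.log ∘ Real.Gamma) (x := z) (n := n)
    Real.convexOn_log_Gamma (fun {y} hy => by
      simp only [Function.comp]
      rw [Real.Gamma_add_one hy.ne', Real.log_mul hy.ne' (Real.Gamma_pos_of_pos hy).ne', add_comm])
    hn hz
  simp only [Function.comp] at h1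
  have h2 := Stirling.le_log_factorial_stirling (n := n) (by omega)
  have h3 : Real.log (n.factorial : ℝ) = Real.log n + Real.log (Real.Gamma n) := by
    rw [← Real.Gamma_nat_eq_factorial, Real.Gamma_add_one hn0.ne',
      Real.log_mul hn0.ne' (Real.Gamma_pos_of_pos hn0).ne']
  have h4 : Real.log (z + n) - Real.log n ≤ z / n := by
    rw [← Real.log_div (by positivity) hn0.ne']
    have := Real.log_le_sub_one_of_pos (x := (z + n) / n) (by positivity)
    have e : (z + n) / n - 1 = z / n := by field_simp; ring
    linarith
  have h5 : Real.log (z + n) - Real.log ((n : ℝ) - 1) ≤ (z + 1) / ((n : ℝ) - 1) := by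
    rw [← Real.log_div (by positivity) hn1.ne']
    have := Real.log_le_sub_one_of_pos (x := (z + n) / ((n : ℝ) - 1)) (by positivity)
    have e : (z + n) / ((n : ℝ) - 1) - 1 = (z + 1) / ((n : ℝ) - 1) := by field_simp; ring
    linarith
  have h6 := mul_le_mul_of_nonneg_left h5 hz.le
  have h7 := mul_le_mul_of_nonneg_left h4 (show 0 ≤ (n : ℝ) - 1/2 by linarith)
  have e7 : ((n : ℝ) - 1/2) * (z / n) = z - z / n / 2 := by field_simp
  have p : 0 < z / n := by positivity
  have e6 : z * ((z + 1) / ((n : ℝ) - 1)) = - (- (z * (z + 1)) / ((n : ℝ) - 1)) := by ring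
  rw [e7] at h7
  rw [e6] at h6
  rw [add_comm (n : ℝ) z] at h1
  unfold muAux
  linarith

lemma muAux_nonneg (z : ℝ) (hz : 0 < z) : 0 ≤ muAux z := by
  have ht : Filter.Tendsto (fun n : ℕ => - (z * (z + 1)) / ((n : ℝ) - 1)) Filter.atTop
      (nhds 0) := by
    apply Filter.Tendsto.const_div_atTop
    exact Filter.tendsto_atTop_add_const_right _ _ tendsto_natCast_atTop_atTop
  refine le_of_tendsto ht ?_
  filter_upwards [Filter.eventually_ge_atTop 2] with n hn
  exact (muAux_ge z hz n hn).trans (muAux_nat z hz n)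

/-- For every positive real `z`, `Γ(z) ≥ √(2π) z^{z-1/2} e^{-z}`. -/
theorem stmt_3 (z : ℝ) (hz : 0 < z) :
    Real.sqrt (2 * π) * z ^ (z - 1/2) * Real.exp (-z) ≤ Real.Gamma z := by
  have hp := Real.pi_pos
  have h := muAux_nonneg z hz
  unfold muAux at h
  rw [← Real.log_le_log_iff (by positivity) (Real.Gamma_pos_of_pos hz),
    Real.log_mul (by positivity) (by positivity), Real.log_mul (by positivity) (by positivity),
    Real.log_exp, Real.log_rpow hz, Real.log_sqrt (by positivity)]
  linarith
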